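/- arXiv:2102.00216 — 3 statements merged into one kernel-verified Lean document; each statement's English description precedes it below -/
import Mathlib

section
/- Fix an integer n ≥ 1, a radius R > 0, and constants λ₁ > 0, λ₂ > 0, b ≤ 0 and 1 < p < 2. Then there exists a constant C > 0, depending only on n, R, λ₁ and p (and in particular not on the solution, nor on λ₂ or b), such that every smooth positive solution u of Δu + λ₁ u ln u + λ₂ u^{b+1} = 0 on the ball B_{2R} ⊂ ℝⁿ satisfies |∇u|²/u² + p λ₁ ln u + λ₂ u^{b} ≤ C at every point of B_R. -/
open Real Metric
open scoped RealInnerProductSpace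

/-- The Euclidean Laplacian: trace of the Hessian, written as the sum of
second partial derivatives in the coordinate directions. -/
noncomputable def lap {n : ℕ} (f : EuclideanSpace ℝ (Fin n) → ℝ)
    (x : EuclideanSpace ℝ (Fin n)) : ℝ :=
  ∑ i : Fin n,
    fderiv ℝ (fun y => fderiv ℝ f y (EuclideanSpace.single i 1)) x
      (EuclideanSpace.single i 1)

open Filter Topology

/-- Second derivative test: at a local maximum the second derivative is nonpositive. -/
lemma second_deriv_nonpos_of_isLocalMax {g g' : ℝ → ℝ} {t c : ℝ}
    (hg : ∀ᶠ s in 𝓝 t, HasDerivAt g (g' s) s) (hc : HasDerivAt g' c t)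
    (hmax : IsLocalMax g t) : c ≤ 0 := by
  by_contra! hpos
  have hd : deriv g =ᶠ[𝓝 t] g' := hg.mono fun s hs => hs.deriv
  have hdd : deriv (deriv g) t = c := hd.deriv_eq.trans hc.deriv
  have hmin : IsLocalMin g t :=
    isLocalMin_of_deriv_deriv_pos (hdd ▸ hpos) hmax.deriv_eq_zero
      hg.self_of_nhds.continuousAt
  have hconst : g =ᶠ[𝓝 t] fun _ => g t := by
    filter_upwards [hmin, hmax] with s h₁ h₂ using le_antisymm h₂ h₁
  have hzero : deriv (deriv g) t = 0 := by
    rw [hconst.deriv.deriv_eq]; simp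
  linarith

section LineDeriv

variable {V : Type*} [NormedAddCommGroup V] [NormedSpace ℝ V] {f g : V → ℝ} {f' g' : ℝ} {x v : V}

lemma HasLineDerivAt.fun_mul (hf : HasLineDerivAt ℝ f f' x v) (hg : HasLineDerivAt ℝ g g' x v) :
    HasLineDerivAt ℝ (fun y => f y * g y) (f' * g x + f x * g') x v := by
  simpa [HasLineDerivAt] using HasDerivAt.fun_mul hf hg

lemma HasLineDerivAt.fun_add (hf : HasLineDerivAt ℝ f f' x v) (hg : HasLineDerivAt ℝ g g' x v) :
    HasLineDerivAt ℝ (fun y => f y + g y) (f' + g') x v :=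
  HasDerivAt.fun_add hf hg

lemma HasLineDerivAt.const_mul (c : ℝ) (hf : HasLineDerivAt ℝ f f' x v) :
    HasLineDerivAt ℝ (fun y => c * f y) (c * f') x v :=
  HasDerivAt.const_mul c hf

lemma HasLineDerivAt.rexp (hf : HasLineDerivAt ℝ f f' x v) :
    HasLineDerivAt ℝ (fun y => Real.exp (f y)) (Real.exp (f x) * f') x v := by
  simpa [HasLineDerivAt] using HasDerivAt.exp hf

lemma HasLineDerivAt.fun_sum {ι : Type*} {s : Finset ι} {A : ι → V → ℝ} {A' : ι → ℝ}
    (h : ∀ i ∈ s, HasLineDerivAt ℝ (A i) (A' i) x v) :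
    HasLineDerivAt ℝ (fun y => ∑ i ∈ s, A i y) (∑ i ∈ s, A' i) x v :=
  HasDerivAt.fun_sum h

lemma HasLineDerivAt.hasDerivAt_shift {t : ℝ} (hf : HasLineDerivAt ℝ f f' (x + t • v) v) :
    HasDerivAt (fun s : ℝ => f (x + s • v)) f' t := by
  have h : HasDerivAt (fun s : ℝ => f (x + t • v + s • v)) f' (t - t) := by
    simpa [HasLineDerivAt] using hf
  have h' := h.comp_sub_const t t
  refine h'.congr_of_eventuallyEq (Eventually.of_forall fun s => ?_)
  simp only [add_assoc, ← add_smul]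
  congr 3
  ring

/-- First and second order conditions at an interior local maximum, along a line. -/
lemma lineDeriv_conditions_of_isLocalMax {h h' : V → ℝ} {c : ℝ}
    (hh : ∀ᶠ y in 𝓝 x, HasLineDerivAt ℝ h (h' y) y v) (hc : HasLineDerivAt ℝ h' c x v)
    (hmax : IsLocalMax h x) : h' x = 0 ∧ c ≤ 0 := by
  have hcont : Tendsto (fun s : ℝ => x + s • v) (𝓝 0) (𝓝 x) := by
    have : Continuous fun s : ℝ => x + s • v := by fun_prop
    simpa using this.tendsto 0
  have hmax' : IsLocalMax (fun s : ℝ => h (x + s • v)) 0 := by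
    filter_upwards [hcont.eventually hmax] with s hs
    simpa using hs
  refine ⟨hmax'.hasDerivAt_eq_zero hh.self_of_nhds, ?_⟩
  exact second_deriv_nonpos_of_isLocalMax (g' := fun s => h' (x + s • v))
    ((hcont.eventually hh).mono fun s hs => hs.hasDerivAt_shift) hc hmax'

end LineDeriv

/-- The scalar inequality closing the maximum principle argument. -/
lemma cutoff_estimate_aux {ν q lam η m M N D F G S Q P : ℝ} (hν : 0 ≤ ν) (hq : 0 < q)
    (hlam : 0 < lam) (hη : 0 < η) (hηm : η ≤ m) (hM0 : 0 ≤ M) (hN : M ≤ N) (hD : 0 < D)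
    (hF : 0 < F) (hFG : F ≤ G) (hGS : G ^ 2 ≤ D * S) (hQG : q * Q ≤ G)
    (hmain : η ^ 2 * (2 * S - lam * G) ≤ F * (6 * M + 4 * ν * η - 4 * η * P))
    (hyoung : ∀ r : ℝ, -4 * r * η * P ≤ η ^ 2 * Q + 4 * r ^ 2 * M) :
    η ^ 2 * F ≤ D * (lam * m ^ 2 + 6 * N + 4 * ν * m + 4 * N * (D / q)) := by
  have hG : 0 < G := hF.trans_le hFG
  obtain ⟨r, hr⟩ : ∃ r, r = D / q := ⟨_, rfl⟩
  have hrq : q * r = D := by rw [hr]; field_simp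
  have hr0 : 0 < r := hr ▸ div_pos hD hq
  rw [← hr]
  have hdrift : D * (-4 * η * P) ≤ η ^ 2 * G + D * (4 * r * M) := by
    have h₁ := mul_le_mul_of_nonneg_left (hyoung r) hq.le
    have h₂ := mul_le_mul_of_nonneg_left hQG (sq_nonneg η)
    rw [← hrq]
    linarith
  have h₁ : η ^ 2 * (2 * G ^ 2 - D * lam * G) ≤ D * (η ^ 2 * (2 * S - lam * G)) := by
    have := mul_le_mul_of_nonneg_left hGS (sq_nonneg η)
    linarith
  have h₂ := mul_le_mul_of_nonneg_left hmain hD.le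
  have h₃ := mul_le_mul_of_nonneg_left hdrift hF.le
  have h₄ : F * (η ^ 2 * G + D * (4 * r * M) + D * (6 * M + 4 * ν * η))
      ≤ G * (η ^ 2 * G + D * (4 * r * M) + D * (6 * M + 4 * ν * η)) :=
    mul_le_mul_of_nonneg_right hFG (by positivity)
  have h₅ : G * (η ^ 2 * G)
      ≤ G * (D * (lam * η ^ 2 + 6 * M + 4 * ν * η + 4 * M * r)) := by linarith
  have h₆ := le_of_mul_le_mul_left h₅ hG
  calc η ^ 2 * F ≤ η ^ 2 * G := by gcongr
    _ ≤ _ := h₆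
    _ ≤ _ := by gcongr

/-- The pointwise inequality behind the maximum principle argument: `a`, `h`, `t` stand for the
first, second and (contracted) third derivatives of `w = log u`, and `η`, `e` for the cutoff and
its gradient, at a maximum of `η² F`. -/
lemma cutoff_estimate {n : ℕ} (hn : 1 ≤ n) {lam p b E ω η m N : ℝ} {a e F₁ F₂ : Fin n → ℝ}
    {h t : Fin n → Fin n → ℝ} {F : ℝ} (hlam : 0 < lam) (hp : 1 < p) (hb : b ≤ 0) (hE : 0 < E)
    (hη : 0 < η) (hηm : η ≤ m) (hN : ∑ j, e j ^ 2 ≤ N)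
    (hpde : ∑ j, h j j + ∑ i, a i ^ 2 + lam * ω + E = 0)
    (hpde' : ∀ i, ∑ j, t i j + 2 * ∑ k, a k * h k i + lam * a i + b * E * a i = 0)
    (hF : F = ∑ i, a i ^ 2 + p * lam * ω + E)
    (hF₁ : ∀ j, F₁ j = 2 * ∑ i, a i * h i j + p * lam * a j + b * E * a j)
    (hF₂ : ∀ j, F₂ j = 2 * ∑ i, (h i j ^ 2 + a i * t i j) + p * lam * h j j
      + b * E * h j j + b ^ 2 * E * a j ^ 2)
    (hFpos : 0 < F)
    (hfirst : ∀ j, η ^ 2 * F₁ j + 2 * η * e j * F = 0)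
    (hsecond : ∀ j, η ^ 2 * F₂ j + 4 * η * e j * F₁ j + (2 * e j ^ 2 - 4 * η) * F ≤ 0) :
    η ^ 2 * F ≤ n * p ^ 2 * (lam * m ^ 2 + 6 * N + 4 * n * m + 4 * N * (n * p ^ 2 / (p - 1))) := by
  have hn' : (1 : ℝ) ≤ n := by exact_mod_cast hn
  set Q := ∑ i, a i ^ 2 with hQ
  set L := ∑ j, h j j with hL
  set S := ∑ j, ∑ i, h i j ^ 2 with hS
  set P := ∑ i, a i * e i with hP
  set M := ∑ j, e j ^ 2 with hM
  have hQ0 : 0 ≤ Q := Finset.sum_nonneg fun _ _ => sq_nonneg _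
  have hM0 : 0 ≤ M := Finset.sum_nonneg fun _ _ => sq_nonneg _
  have hLS : L ^ 2 ≤ n * S := by
    have h₁ : L ^ 2 ≤ n * ∑ j, h j j ^ 2 := by
      simpa using sq_sum_le_card_mul_sum_sq (s := Finset.univ) (f := fun j => h j j)
    have h₂ : ∑ j, h j j ^ 2 ≤ S := Finset.sum_le_sum fun j _ =>
      Finset.single_le_sum (f := fun i => h i j ^ 2) (fun _ _ => sq_nonneg _) (Finset.mem_univ j)
    nlinarith
  have hfirst' : ∀ j, η * F₁ j = -2 * e j * F := fun j => by
    have : η * (η * F₁ j + 2 * e j * F) = 0 := by linarith [hfirst j]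
    rcases mul_eq_zero.1 this with h0 | h0 <;> linarith
  have hsumT : ∑ j, ∑ i, a i * t i j = -∑ i, a i * F₁ i + (p - 1) * lam * Q := by
    rw [Finset.sum_comm, hQ, Finset.mul_sum, ← Finset.sum_neg_distrib, ← Finset.sum_add_distrib]
    refine Finset.sum_congr rfl fun i _ => ?_
    rw [← Finset.mul_sum]
    linear_combination a i * hpde' i + a i * hF₁ i
  have hsumF₂ : ∑ j, F₂ j = 2 * S + 2 * (-∑ i, a i * F₁ i + (p - 1) * lam * Q)
      + (p * lam + b * E) * L + b ^ 2 * E * Q := by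
    rw [← hsumT, hS, hL, hQ]
    simp only [Finset.mul_sum, ← Finset.sum_add_distrib]
    refine Finset.sum_congr rfl fun j _ => ?_
    rw [hF₂ j, Finset.mul_sum, Finset.sum_congr rfl fun i _ => mul_add _ _ _,
      Finset.sum_add_distrib]
    ring
  have haF : η * ∑ i, a i * F₁ i = -2 * F * P := by
    rw [hP, Finset.mul_sum, Finset.mul_sum]
    exact Finset.sum_congr rfl fun i _ => by linear_combination a i * hfirst' i
  have hsum : η ^ 2 * ∑ j, F₂ j ≤ (6 * M + 4 * n * η) * F := by
    have h₁ : ∑ j, (η ^ 2 * F₂ j + (-6 * e j ^ 2 * F + -4 * η * F)) ≤ 0 :=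
      Finset.sum_nonpos fun j _ => by
        have : η * e j * F₁ j = -2 * e j ^ 2 * F := by linear_combination e j * hfirst' j
        linarith [hsecond j]
    rw [Finset.sum_add_distrib, Finset.sum_add_distrib, ← Finset.mul_sum, ← Finset.sum_mul,
      ← Finset.mul_sum] at h₁
    simp at h₁
    linarith
  have hp0 : 0 < p := by linarith
  set G := F + (p - 1) * (Q + E) with hG
  have hLG : p * L = -G := by
    rw [hG]; linear_combination p * hpde + hF
  have hQG : (p - 1) * Q ≤ G := by
    have := mul_pos (sub_pos.2 hp) hE
    rw [hG]; linarith
  have hFG : F ≤ G := by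
    have := mul_nonneg (sub_pos.2 hp).le (add_nonneg hQ0 hE.le)
    linarith
  have hGpos : 0 < G := hFpos.trans_le hFG
  set D := n * p ^ 2 with hD
  have hDpos : 0 < D := by positivity
  have hGS : G ^ 2 ≤ D * S := by
    have : G ^ 2 = p ^ 2 * L ^ 2 := by linear_combination -(p * L - G) * hLG
    rw [this, hD]
    nlinarith [sq_nonneg p]
  have hmain : η ^ 2 * (2 * S - lam * G) ≤ F * (6 * M + 4 * n * η - 4 * η * P) := by
    have hbL : 0 ≤ b * E * L := by
      have hL0 : L ≤ 0 := by nlinarith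
      exact mul_nonneg_of_nonpos_of_nonpos (mul_nonpos_of_nonpos_of_nonneg hb hE.le) hL0
    have h₁ : 0 ≤ (p - 1) * lam * Q := by
      have := sub_pos.2 hp; positivity
    have h₂ : 0 ≤ b ^ 2 * E * Q := by positivity
    have h₃ : 2 * S - lam * G - 2 * ∑ i, a i * F₁ i ≤ ∑ j, F₂ j := by
      rw [hsumF₂]
      linarith [congrArg (lam * ·) hLG]
    have h₄ := mul_le_mul_of_nonneg_left h₃ (sq_nonneg η)
    have h₅ : η ^ 2 * ∑ i, a i * F₁ i = -2 * η * F * P := by linear_combination η * haF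
    linarith
  have hyoung : ∀ r : ℝ, -4 * r * η * P ≤ η ^ 2 * Q + 4 * r ^ 2 * M := fun r => by
    have h₁ : 0 ≤ ∑ i, (η * a i + 2 * r * e i) ^ 2 := Finset.sum_nonneg fun _ _ => sq_nonneg _
    have h₂ : ∑ i, (η * a i + 2 * r * e i) ^ 2 = η ^ 2 * Q + 4 * r * η * P + 4 * r ^ 2 * M := by
      rw [hQ, hP, hM]
      simp only [Finset.mul_sum, ← Finset.sum_add_distrib]
      exact Finset.sum_congr rfl fun i _ => by ring
    linarith
  exact cutoff_estimate_aux n.cast_nonneg (sub_pos.2 hp) hlam hη hηm hM0 hN hDpos hFpos hFG hGS hQG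
    hmain hyoung

section PartialDeriv

variable {n : ℕ} {f g w : EuclideanSpace ℝ (Fin n) → ℝ} {U : Set (EuclideanSpace ℝ (Fin n))}
  {x : EuclideanSpace ℝ (Fin n)}

/-- The `i`-th partial derivative. -/
noncomputable def pd (i : Fin n) (f : EuclideanSpace ℝ (Fin n) → ℝ)
    (x : EuclideanSpace ℝ (Fin n)) : ℝ :=
  fderiv ℝ f x (EuclideanSpace.single i 1)

lemma ContDiffOn.pd (hf : ContDiffOn ℝ (⊤ : ℕ∞) f U) (hU : IsOpen U) (i : Fin n) :
    ContDiffOn ℝ (⊤ : ℕ∞) (pd i f) U :=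
  (hf.fderiv_of_isOpen hU (by simp)).clm_apply contDiffOn_const

lemma ContDiffOn.hasLineDerivAt_pd (hf : ContDiffOn ℝ (⊤ : ℕ∞) f U) (hU : IsOpen U) (hx : x ∈ U)
    (i : Fin n) : HasLineDerivAt ℝ f (_root_.pd i f x) x (EuclideanSpace.single i 1) :=
  ((hf.contDiffAt (hU.mem_nhds hx)).differentiableAt (by simp)).hasFDerivAt.hasLineDerivAt _

lemma pd_congr (hU : IsOpen U) (hfg : Set.EqOn f g U) (i : Fin n) : Set.EqOn (pd i f) (pd i g) U :=
  fun x hx => by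
    have : f =ᶠ[𝓝 x] g := hfg.eventuallyEq_of_mem (hU.mem_nhds hx)
    rw [pd, pd, this.fderiv_eq]

lemma pd_comm (hf : ContDiffOn ℝ (⊤ : ℕ∞) f U) (hU : IsOpen U) (i j : Fin n) :
    Set.EqOn (pd j (pd i f)) (pd i (pd j f)) U := fun x hx => by
  have hsymm : IsSymmSndFDerivAt ℝ f x :=
    (hf.contDiffAt (hU.mem_nhds hx)).isSymmSndFDerivAt
      (by simpa using WithTop.coe_le_coe.2 (le_top : (2 : ℕ∞) ≤ ⊤))
  have hd : DifferentiableAt ℝ (fderiv ℝ f) x :=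
    ((hf.fderiv_of_isOpen hU (m := (⊤ : ℕ∞)) (by simp)).contDiffAt
      (hU.mem_nhds hx)).differentiableAt (by simp)
  have key : ∀ v v' : EuclideanSpace ℝ (Fin n),
      fderiv ℝ (fun y => fderiv ℝ f y v) x v' = fderiv ℝ (fderiv ℝ f) x v' v := fun v v' => by
    rw [fderiv_clm_apply hd (differentiableAt_const _)]
    simp
  exact (key _ _).trans ((hsymm _ _).trans (key _ _).symm)

lemma HasLineDerivAt.pd_eq {c : ℝ} {i : Fin n}
    (h : HasLineDerivAt ℝ f c x (EuclideanSpace.single i 1)) (hd : DifferentiableAt ℝ f x) :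
    pd i f x = c :=
  (hd.hasFDerivAt.hasLineDerivAt _).unique h

lemma norm_gradient_sq (f : EuclideanSpace ℝ (Fin n) → ℝ) (x : EuclideanSpace ℝ (Fin n)) :
    ‖gradient f x‖ ^ 2 = ∑ i, pd i f x ^ 2 := by
  rw [EuclideanSpace.norm_sq_eq]
  refine Finset.sum_congr rfl fun i _ => ?_
  have h : gradient f x i = pd i f x := by
    rw [pd, ← inner_gradient_left, EuclideanSpace.inner_single_right]
    simp
  rw [h, Real.norm_eq_abs, sq_abs]

/-- Local estimate for `w = log u`, which solves `Δw + |∇w|² + λ₁ w + λ₂ exp (b w) = 0`. -/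
lemma log_solution_estimate (hn : 1 ≤ n) {R lam lam₂ p b : ℝ} (hR : 0 < R) (hlam : 0 < lam)
    (hp : 1 < p) (hlam₂ : 0 < lam₂) (hb : b ≤ 0)
    (hw : ContDiffOn ℝ (⊤ : ℕ∞) w (ball 0 (2 * R)))
    (hpde : ∀ y ∈ ball (0 : EuclideanSpace ℝ (Fin n)) (2 * R),
      ∑ j, pd j (pd j w) y + ∑ i, pd i w y ^ 2 + lam * w y + lam₂ * Real.exp (b * w y) = 0)
    (hx : x ∈ ball (0 : EuclideanSpace ℝ (Fin n)) R)
    (hpos : 0 < ∑ i, pd i w x ^ 2 + p * lam * w x + lam₂ * Real.exp (b * w x)) :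
    (5 / 4 * R ^ 2) ^ 2 * (∑ i, pd i w x ^ 2 + p * lam * w x + lam₂ * Real.exp (b * w x)) ≤
      n * p ^ 2 * (lam * (9 / 4 * R ^ 2) ^ 2 + 6 * (9 * R ^ 2) + 4 * n * (9 / 4 * R ^ 2)
        + 4 * (9 * R ^ 2) * (n * p ^ 2 / (p - 1))) := by
  set U := ball (0 : EuclideanSpace ℝ (Fin n)) (2 * R)
  have hU : IsOpen U := isOpen_ball
  have hw₁ : ∀ i, ContDiffOn ℝ (⊤ : ℕ∞) (pd i w) U := fun i => hw.pd hU i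
  have hw₂ : ∀ i j, ContDiffOn ℝ (⊤ : ℕ∞) (pd j (pd i w)) U := fun i j => (hw₁ i).pd hU j
  let F : EuclideanSpace ℝ (Fin n) → ℝ := fun y =>
    ∑ i, pd i w y * pd i w y + p * lam * w y + lam₂ * Real.exp (b * w y)
  let F₁ : Fin n → EuclideanSpace ℝ (Fin n) → ℝ := fun j y =>
    ∑ i, (pd j (pd i w) y * pd i w y + pd i w y * pd j (pd i w) y) + p * lam * pd j w y
      + lam₂ * (Real.exp (b * w y) * (b * pd j w y))
  let F₂ : Fin n → EuclideanSpace ℝ (Fin n) → ℝ := fun j y =>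
    ∑ i, (pd j (pd j (pd i w)) y * pd i w y + pd j (pd i w) y * pd j (pd i w) y
        + (pd j (pd i w) y * pd j (pd i w) y + pd i w y * pd j (pd j (pd i w)) y))
      + p * lam * pd j (pd j w) y
      + lam₂ * (Real.exp (b * w y) * (b * pd j w y) * (b * pd j w y)
        + Real.exp (b * w y) * (b * pd j (pd j w) y))
  have hF₁ : ∀ j, ∀ y ∈ U, HasLineDerivAt ℝ F (F₁ j y) y (EuclideanSpace.single j 1) :=
    fun j y hy => by
      have d₀ := hw.hasLineDerivAt_pd hU hy j
      have d₁ := fun i => (hw₁ i).hasLineDerivAt_pd hU hy j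
      exact ((HasLineDerivAt.fun_sum fun i _ => (d₁ i).fun_mul (d₁ i)).fun_add
        (d₀.const_mul _)).fun_add ((d₀.const_mul b).rexp.const_mul lam₂)
  have hF₂ : ∀ j, ∀ y ∈ U, HasLineDerivAt ℝ (F₁ j) (F₂ j y) y (EuclideanSpace.single j 1) :=
    fun j y hy => by
      have d₀ := hw.hasLineDerivAt_pd hU hy j
      have d₁ := fun i => (hw₁ i).hasLineDerivAt_pd hU hy j
      have d₂ := fun i => (hw₂ i j).hasLineDerivAt_pd hU hy j
      exact ((HasLineDerivAt.fun_sum fun i _ =>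
        ((d₂ i).fun_mul (d₁ i)).fun_add ((d₁ i).fun_mul (d₂ i))).fun_add
        ((d₁ j).const_mul _)).fun_add
        (((d₀.const_mul b).rexp.fun_mul ((d₁ j).const_mul b)).const_mul lam₂)
  have hFcont : ContinuousOn F U := by
    have c₀ := hw.continuousOn
    have c₁ := fun i => (hw₁ i).continuousOn
    fun_prop
  let η : EuclideanSpace ℝ (Fin n) → ℝ := fun y => 9 / 4 * R ^ 2 - ‖y‖ ^ 2
  have hη : ∀ (j : Fin n) y, HasLineDerivAt ℝ η (-2 * y j) y (EuclideanSpace.single j 1) :=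
    fun j y => by
      have h := ((hasStrictFDerivAt_norm_sq y).hasFDerivAt.const_sub
        (9 / 4 * R ^ 2)).hasLineDerivAt (EuclideanSpace.single j 1)
      have hval : (-(2 • innerSL ℝ y)) (EuclideanSpace.single j 1) = -2 * y j := by
        simp [EuclideanSpace.inner_single_right]
      exact hval ▸ h
  have hη₁ : ∀ (j : Fin n) (y : EuclideanSpace ℝ (Fin n)),
      HasLineDerivAt ℝ (fun y => -2 * y j) (-2 : ℝ) y (EuclideanSpace.single j 1) := fun j y => by
    have h := ((EuclideanSpace.proj (𝕜 := ℝ) j).hasFDerivAt (x := y)).hasLineDerivAt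
      (EuclideanSpace.single j 1)
    simpa using h.const_mul (-2)
  let H : EuclideanSpace ℝ (Fin n) → ℝ := fun y => η y * η y * F y
  have hηcont : Continuous η := by fun_prop
  have hsub : closedBall (0 : EuclideanSpace ℝ (Fin n)) (3 / 2 * R) ⊆ U :=
    closedBall_subset_ball (by linarith)
  have hxK : x ∈ closedBall (0 : EuclideanSpace ℝ (Fin n)) (3 / 2 * R) :=
    ball_subset_closedBall (ball_subset_ball (by linarith) hx)
  obtain ⟨z, hzK, hzmax⟩ := (isCompact_closedBall (0 : EuclideanSpace ℝ (Fin n))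
    (3 / 2 * R)).exists_isMaxOn ⟨x, hxK⟩
    (((hηcont.mul hηcont).continuousOn.mul (hFcont.mono hsub)) : ContinuousOn H _)
  have hFx : F x = ∑ i, pd i w x ^ 2 + p * lam * w x + lam₂ * Real.exp (b * w x) := by
    simp only [F, sq]
  rw [← hFx] at hpos ⊢
  have hηx : 5 / 4 * R ^ 2 ≤ η x := by
    have h₁ : ‖x‖ < R := by simpa using hx
    have : ‖x‖ ^ 2 ≤ R ^ 2 := by gcongr
    simp only [η]
    linarith
  have hηxpos : 0 < η x := lt_of_lt_of_le (by positivity) hηx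
  have hHxz : H x ≤ H z := hzmax hxK
  have hHz : 0 < H z := lt_of_lt_of_le (by positivity) hHxz
  have hznorm : ‖z‖ ≤ 3 / 2 * R := by simpa using hzK
  have hzsq : ‖z‖ ^ 2 ≤ 9 / 4 * R ^ 2 := by
    have : ‖z‖ ^ 2 ≤ (3 / 2 * R) ^ 2 := by gcongr
    linarith
  have hηz : 0 < η z := by
    have h₀ : 0 ≤ η z := sub_nonneg.2 hzsq
    refine h₀.lt_of_ne fun h => ?_
    simp [H, ← h] at hHz
  have hFz : 0 < F z := pos_of_mul_pos_right hHz (by positivity)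
  have hzball : z ∈ ball (0 : EuclideanSpace ℝ (Fin n)) (3 / 2 * R) := by
    rw [mem_ball_zero_iff]
    refine hznorm.lt_of_ne fun h => ?_
    simp only [η, h] at hηz
    linarith
  have hzU : z ∈ U := hsub hzK
  have hmax : IsLocalMax H z := hzmax.isLocalMax
    (mem_of_superset (isOpen_ball.mem_nhds hzball) ball_subset_closedBall)
  have hcond : ∀ j, _ ∧ _ := fun j => lineDeriv_conditions_of_isLocalMax
    (h := H) (v := EuclideanSpace.single j 1)
    (by
      filter_upwards [hU.mem_nhds hzU] with y hy
      exact ((hη j y).fun_mul (hη j y)).fun_mul (hF₁ j y hy))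
    (((((hη₁ j z).fun_mul (hη j z)).fun_add ((hη j z).fun_mul (hη₁ j z))).fun_mul
      (hF₁ j z hzU)).fun_add (((hη j z).fun_mul (hη j z)).fun_mul (hF₂ j z hzU))) hmax
  have hpde' : ∀ i, ∑ j, pd j (pd j (pd i w)) z + 2 * ∑ k, pd k w z * pd i (pd k w) z
      + lam * pd i w z + b * (lam₂ * Real.exp (b * w z)) * pd i w z = 0 := fun i => by
    have d₀ := hw.hasLineDerivAt_pd hU hzU i
    have d₁ := fun k => (hw₁ k).hasLineDerivAt_pd hU hzU i
    have d₂ := fun k => (hw₂ k k).hasLineDerivAt_pd hU hzU i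
    have hd := (((HasLineDerivAt.fun_sum (s := Finset.univ) fun k _ => d₂ k).fun_add
      (HasLineDerivAt.fun_sum (s := Finset.univ) fun k _ => (d₁ k).fun_mul (d₁ k))).fun_add
      (d₀.const_mul lam)).fun_add ((d₀.const_mul b).rexp.const_mul lam₂)
    have hzero : HasLineDerivAt ℝ (fun _ : EuclideanSpace ℝ (Fin n) => (0 : ℝ)) 0 z
        (EuclideanSpace.single i 1) := hasDerivAt_const _ _
    have heq := hd.unique (hzero.congr_of_eventuallyEq (by
      filter_upwards [hU.mem_nhds hzU] with y hy
      simpa only [sq] using hpde y hy))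
    have hcomm : ∀ j, pd j (pd j (pd i w)) z = pd i (pd j (pd j w)) z := fun j =>
      (pd_congr hU (pd_comm hw hU i j) j hzU).trans (pd_comm (hw₁ j) hU i j hzU)
    rw [Finset.sum_congr rfl fun j _ => hcomm j, ← heq, Finset.mul_sum]
    rw [Finset.sum_congr rfl fun k _ =>
      (by ring : 2 * (pd k w z * pd i (pd k w) z)
        = pd i (pd k w) z * pd k w z + pd k w z * pd i (pd k w) z)]
    ring
  have hest := cutoff_estimate (n := n) (a := fun i => pd i w z)
    (e := fun j => -2 * z j) (F₁ := fun j => F₁ j z) (F₂ := fun j => F₂ j z)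
    (h := fun i j => pd j (pd i w) z) (t := fun i j => pd j (pd j (pd i w)) z)
    (E := lam₂ * Real.exp (b * w z)) (ω := w z) (η := η z) (m := 9 / 4 * R ^ 2) (N := 9 * R ^ 2)
    (F := F z) hn hlam hp hb (by positivity) hηz
    (by simp only [η]; linarith [sq_nonneg ‖z‖])
    (by
      simp only [mul_pow, ← Finset.mul_sum]
      have := EuclideanSpace.real_norm_sq_eq z
      linarith)
    (by linarith [hpde z hzU]) hpde' (by simp only [F, sq])
    (fun j => by
      simp only [F₁, Finset.mul_sum]
      rw [Finset.sum_congr rfl fun i _ =>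
        (by ring : pd j (pd i w) z * pd i w z + pd i w z * pd j (pd i w) z
          = 2 * (pd i w z * pd j (pd i w) z))]
      ring)
    (fun j => by
      simp only [F₂, Finset.mul_sum]
      rw [Finset.sum_congr rfl fun i _ =>
        (by ring : pd j (pd j (pd i w)) z * pd i w z + pd j (pd i w) z * pd j (pd i w) z
          + (pd j (pd i w) z * pd j (pd i w) z + pd i w z * pd j (pd j (pd i w)) z)
          = 2 * (pd j (pd i w) z ^ 2 + pd i w z * pd j (pd j (pd i w)) z))]
      ring)
    hFz (fun j => by linear_combination (hcond j).1) (fun j => by linarith [(hcond j).2])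
  refine le_trans ?_ hest
  calc (5 / 4 * R ^ 2) ^ 2 * F x ≤ η x ^ 2 * F x := by gcongr
    _ = H x := by simp only [H]; ring
    _ ≤ H z := hHxz
    _ = η z ^ 2 * F z := by simp only [H]; ring

/-- The logarithm of a positive solution `u` of `Δu + λ₁ u log u + λ₂ u ^ (b + 1) = 0` satisfies
`Δw + |∇w|² + λ₁ w + λ₂ exp (b w) = 0`. -/
lemma pde_log {lam lam₂ b : ℝ} {u : EuclideanSpace ℝ (Fin n) → ℝ} (hU : IsOpen U)
    (hu : ContDiffOn ℝ (⊤ : ℕ∞) u U) (hw : ContDiffOn ℝ (⊤ : ℕ∞) w U)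
    (huw : Set.EqOn u (fun y => Real.exp (w y)) U) (hx : x ∈ U)
    (hpde : lap u x + lam * u x * Real.log (u x) + lam₂ * u x ^ (b + 1) = 0) :
    (∀ i, pd i u x = u x * pd i w x) ∧
    ∑ j, pd j (pd j w) x + ∑ i, pd i w x ^ 2 + lam * w x + lam₂ * Real.exp (b * w x) = 0 := by
  have hdiff : ∀ {f : EuclideanSpace ℝ (Fin n) → ℝ}, ContDiffOn ℝ (⊤ : ℕ∞) f U → ∀ {y}, y ∈ U → DifferentiableAt ℝ f y :=
    fun hf _ hy => (hf.contDiffAt (hU.mem_nhds hy)).differentiableAt (by simp)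
  have hfirst : ∀ i, Set.EqOn (pd i u) (fun y => u y * pd i w y) U := fun i y hy => by
    refine HasLineDerivAt.pd_eq ?_ (hdiff hu hy)
    beta_reduce
    rw [huw hy]
    exact (hw.hasLineDerivAt_pd hU hy i).rexp.congr_of_eventuallyEq
      (huw.eventuallyEq_of_mem (hU.mem_nhds hy))
  have hsecond : ∀ i, pd i (pd i u) x = u x * (pd i (pd i w) x + pd i w x ^ 2) := fun i => by
    have h := ((hu.hasLineDerivAt_pd hU hx i).fun_mul
      ((hw.pd hU i).hasLineDerivAt_pd hU hx i)).pd_eq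
      (hdiff (hu.mul (hw.pd hU i)) hx)
    rw [pd_congr hU (hfirst i) i hx, h, hfirst i hx]
    ring
  refine ⟨fun i => hfirst i hx, ?_⟩
  have hlap : lap u x = u x * (∑ j, pd j (pd j w) x + ∑ i, pd i w x ^ 2) := by
    rw [← Finset.sum_add_distrib, Finset.mul_sum]
    exact Finset.sum_congr rfl fun i _ => hsecond i
  have hux : u x = Real.exp (w x) := huw hx
  have hupos : 0 < u x := hux ▸ Real.exp_pos _
  have hlog : Real.log (u x) = w x := by rw [hux, Real.log_exp]
  have hpow : u x ^ (b + 1) = u x * Real.exp (b * w x) := by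
    rw [Real.rpow_add hupos, Real.rpow_one, Real.rpow_def_of_pos hupos, hlog]
    ring_nf
  rw [hlap, hlog, hpow] at hpde
  refine (mul_eq_zero.1 (?_ : u x * _ = 0)).resolve_left hupos.ne'
  linear_combination hpde

end PartialDeriv


/-- Theorem 1.1, Case 1 (Euclidean case `K = 0`): local gradient estimate for positive
solutions of `Δu + λ₁ u ln u + λ₂ u^(b+1) = 0` with `λ₁ > 0`, `λ₂ > 0`, `b ≤ 0`,
`1 < p < 2`.  The constant depends only on `n`, `R`, `λ₁`, `p`. -/
theorem stmt_0 (n : ℕ) (hn : 1 ≤ n) (R lam1 p : ℝ) (hR : 0 < R) (hlam1 : 0 < lam1)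
    (hp1 : 1 < p) (hp2 : p < 2) :
    ∃ C : ℝ, 0 < C ∧
      ∀ (lam2 b : ℝ), 0 < lam2 → b ≤ 0 →
        ∀ u : EuclideanSpace ℝ (Fin n) → ℝ,
          ContDiffOn ℝ (⊤ : ℕ∞) u (ball (0 : EuclideanSpace ℝ (Fin n)) (2 * R)) →
          (∀ x ∈ ball (0 : EuclideanSpace ℝ (Fin n)) (2 * R), 0 < u x) →
          (∀ x ∈ ball (0 : EuclideanSpace ℝ (Fin n)) (2 * R),
            lap u x + lam1 * u x * Real.log (u x) + lam2 * u x ^ (b + 1) = 0) →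
          ∀ x ∈ ball (0 : EuclideanSpace ℝ (Fin n)) R,
            ‖gradient u x‖ ^ 2 / u x ^ 2 + p * lam1 * Real.log (u x) + lam2 * u x ^ b ≤ C := by
  have hp0 : 0 < p := by linarith
  have hq : 0 < p - 1 := sub_pos.2 hp1
  have hn' : (0 : ℝ) < n := by exact_mod_cast hn
  obtain ⟨K, hKdef⟩ : ∃ K : ℝ, K = n * p ^ 2 * (lam1 * (9 / 4 * R ^ 2) ^ 2 + 6 * (9 * R ^ 2)
    + 4 * n * (9 / 4 * R ^ 2) + 4 * (9 * R ^ 2) * (n * p ^ 2 / (p - 1))) := ⟨_, rfl⟩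
  have hK : 0 < K := by rw [hKdef]; positivity
  have hc : 0 < (5 / 4 * R ^ 2) ^ 2 := by positivity
  have hC : 0 < K / (5 / 4 * R ^ 2) ^ 2 := div_pos hK hc
  refine ⟨K / (5 / 4 * R ^ 2) ^ 2, hC, fun lam2 b hlam2 hb u hu hupos hpde x hx => ?_⟩
  have hU : IsOpen (ball (0 : EuclideanSpace ℝ (Fin n)) (2 * R)) := isOpen_ball
  have hxU : x ∈ ball (0 : EuclideanSpace ℝ (Fin n)) (2 * R) :=
    ball_subset_ball (by linarith) hx
  have hw : ContDiffOn ℝ (⊤ : ℕ∞) (fun y => Real.log (u y))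
      (ball (0 : EuclideanSpace ℝ (Fin n)) (2 * R)) := hu.log fun y hy => (hupos y hy).ne'
  have huw : Set.EqOn u (fun y => Real.exp (Real.log (u y)))
      (ball (0 : EuclideanSpace ℝ (Fin n)) (2 * R)) :=
    fun y hy => (Real.exp_log (hupos y hy)).symm
  have hlogpde := fun y hy => pde_log hU hu hw huw hy (hpde y hy)
  have hux := hupos x hxU
  have hgrad : ‖gradient u x‖ ^ 2 / u x ^ 2 = ∑ i, pd i (fun y => Real.log (u y)) x ^ 2 := by
    rw [norm_gradient_sq, Finset.sum_div]
    refine Finset.sum_congr rfl fun i _ => ?_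
    rw [(hlogpde x hxU).1 i]
    field_simp
  rw [hgrad, Real.rpow_def_of_pos hux, mul_comm (Real.log (u x)) b]
  by_contra! hlt
  refine hlt.not_ge ((le_div_iff₀' hc).2 ?_)
  rw [hKdef]
  exact log_solution_estimate hn hR hlam1 hp1 hlam2 hb hw (fun y hy => (hlogpde y hy).2) hx
    (hC.trans hlt)
end

section
/- Let n ≥ 1 be an integer and let λ₁ > 0, λ₂ > 0 and b < 0 be constants. Then there exist constants 0 < m ≤ M < ∞, depending only on n, λ₁, λ₂ and b, such that every smooth positive solution u of Δu + λ₁ u ln u + λ₂ u^{b+1} = 0 on all of ℝⁿ satisfies m ≤ u(x) ≤ M for every x ∈ ℝⁿ. -/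
open Real Metric

/-- The `i`-th partial derivative of a function on Euclidean space. -/
noncomputable def partialDeriv {n : ℕ} (i : Fin n) (f : EuclideanSpace ℝ (Fin n) → ℝ)
    (x : EuclideanSpace ℝ (Fin n)) : ℝ :=
  fderiv ℝ f x (EuclideanSpace.single i 1)

/-- The squared norm of the gradient. -/
noncomputable def gradSq {n : ℕ} (f : EuclideanSpace ℝ (Fin n) → ℝ)
    (x : EuclideanSpace ℝ (Fin n)) : ℝ :=
  ∑ i : Fin n, partialDeriv i f x ^ 2

section Calculus

variable {n : ℕ} {f g : EuclideanSpace ℝ (Fin n) → ℝ} {x p : EuclideanSpace ℝ (Fin n)}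

theorem lap_eq_sum_partialDeriv (f : EuclideanSpace ℝ (Fin n) → ℝ)
    (x : EuclideanSpace ℝ (Fin n)) :
    lap f x = ∑ i, partialDeriv i (partialDeriv i f) x := rfl

theorem gradSq_nonneg (f : EuclideanSpace ℝ (Fin n) → ℝ) (x : EuclideanSpace ℝ (Fin n)) :
    0 ≤ gradSq f x :=
  Finset.sum_nonneg fun _ _ => sq_nonneg _

theorem ContDiff.partialDeriv (hf : ContDiff ℝ (⊤ : ℕ∞) f) (i : Fin n) :
    ContDiff ℝ (⊤ : ℕ∞) (partialDeriv i f) :=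
  (hf.fderiv_right (m := (⊤ : ℕ∞)) (by simp)).clm_apply contDiff_const

theorem ContDiff.gradSq (hf : ContDiff ℝ (⊤ : ℕ∞) f) : ContDiff ℝ (⊤ : ℕ∞) (gradSq f) :=
  ContDiff.sum fun i _ => (hf.partialDeriv i).pow 2

theorem ContDiff.differentiableAt_top (hf : ContDiff ℝ (⊤ : ℕ∞) f) :
    DifferentiableAt ℝ f x :=
  hf.differentiable (by simp) x

theorem partialDeriv_add (hf : DifferentiableAt ℝ f x) (hg : DifferentiableAt ℝ g x)
    (i : Fin n) :
    partialDeriv i (fun y => f y + g y) x = partialDeriv i f x + partialDeriv i g x := by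
  simp [partialDeriv, fderiv_fun_add hf hg]

theorem partialDeriv_mul (hf : DifferentiableAt ℝ f x) (hg : DifferentiableAt ℝ g x)
    (i : Fin n) :
    partialDeriv i (fun y => f y * g y) x =
      f x * partialDeriv i g x + partialDeriv i f x * g x := by
  simp [partialDeriv, fderiv_fun_mul hf hg]
  ring

theorem partialDeriv_const_mul (hf : DifferentiableAt ℝ f x) (c : ℝ) (i : Fin n) :
    partialDeriv i (fun y => c * f y) x = c * partialDeriv i f x := by
  simp [partialDeriv, fderiv_const_mul hf]

theorem partialDeriv_sum {ι : Type*} {s : Finset ι} {F : ι → EuclideanSpace ℝ (Fin n) → ℝ}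
    (hF : ∀ k ∈ s, DifferentiableAt ℝ (F k) x) (i : Fin n) :
    partialDeriv i (fun y => ∑ k ∈ s, F k y) x = ∑ k ∈ s, partialDeriv i (F k) x := by
  simp [partialDeriv, fderiv_fun_sum hF]

theorem partialDeriv_comp {φ : ℝ → ℝ} {φ' : ℝ} (hφ : HasDerivAt φ φ' (f x))
    (hf : DifferentiableAt ℝ f x) (i : Fin n) :
    partialDeriv i (fun y => φ (f y)) x = φ' * partialDeriv i f x := by
  have := (hφ.comp_hasFDerivAt x hf.hasFDerivAt).fderiv
  simp only [partialDeriv]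
  change (fderiv ℝ (φ ∘ f) x) _ = _
  rw [this]
  simp

theorem partialDeriv_comm (hf : ContDiff ℝ (⊤ : ℕ∞) f) (i j : Fin n) :
    partialDeriv i (partialDeriv j f) x = partialDeriv j (partialDeriv i f) x := by
  have key : ∀ k l : Fin n, partialDeriv k (partialDeriv l f) x =
      fderiv ℝ (fderiv ℝ f) x (EuclideanSpace.single k 1) (EuclideanSpace.single l 1) := by
    intro k l
    have hd : DifferentiableAt ℝ (fderiv ℝ f) x :=
      (hf.fderiv_right (m := (⊤ : ℕ∞)) (by simp)).differentiable (by simp) x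
    have h := (hd.hasFDerivAt.clm_apply
      (hasFDerivAt_const (EuclideanSpace.single l (1 : ℝ)) x)).fderiv
    change (fderiv ℝ (fun y => fderiv ℝ f y (EuclideanSpace.single l 1)) x) _ = _
    rw [h]
    simp
  rw [key, key]
  refine (hf.contDiffAt.isSymmSndFDerivAt ?_).eq _ _
  rw [minSmoothness_of_isRCLikeNormedField]
  exact WithTop.coe_le_coe.2 le_top

theorem norm_fderiv_le_sqrt_gradSq (f : EuclideanSpace ℝ (Fin n) → ℝ)
    (x : EuclideanSpace ℝ (Fin n)) : ‖fderiv ℝ f x‖ ≤ √(gradSq f x) := by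
  refine ContinuousLinearMap.opNorm_le_bound _ (Real.sqrt_nonneg _) fun h => ?_
  have hh : fderiv ℝ f x h = ∑ i, partialDeriv i f x * h i := by
    conv_lhs => rw [← (EuclideanSpace.basisFun (Fin n) ℝ).sum_repr h]
    simp [partialDeriv, mul_comm]
  rw [hh, EuclideanSpace.norm_eq, ← Real.sqrt_mul (gradSq_nonneg f x), Real.norm_eq_abs]
  refine Real.abs_le_sqrt ?_
  simpa [gradSq] using
    Finset.sum_mul_sq_le_sq_mul_sq Finset.univ (fun i => partialDeriv i f x) (fun i => h i)

/-- The second derivative is nonpositive at a local maximum. -/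
theorem IsLocalMax.deriv_deriv_nonpos {φ : ℝ → ℝ} {a : ℝ} (h : IsLocalMax φ a)
    (hc : ContinuousAt φ a) : deriv (deriv φ) a ≤ 0 := by
  by_contra! hpos
  have hmin := isLocalMin_of_deriv_deriv_pos hpos h.deriv_eq_zero hc
  have hconst : φ =ᶠ[nhds a] fun _ => φ a := by
    filter_upwards [h, hmin] with y h1 h2 using le_antisymm h1 h2
  have := hconst.deriv.deriv_eq
  simp at this
  linarith

theorem IsLocalMax.partialDeriv_eq_zero (h : IsLocalMax f p) (i : Fin n) :
    partialDeriv i f p = 0 := by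
  simp [partialDeriv, h.fderiv_eq_zero]

theorem IsLocalMax.partialDeriv_partialDeriv_nonpos (h : IsLocalMax f p)
    (hf : ContDiff ℝ (⊤ : ℕ∞) f) (i : Fin n) :
    partialDeriv i (partialDeriv i f) p ≤ 0 := by
  set e : EuclideanSpace ℝ (Fin n) := EuclideanSpace.single i 1 with he
  have hline : ∀ t : ℝ, HasDerivAt (fun t : ℝ => p + t • e) e t := fun t => by
    simpa using ((hasDerivAt_id t).smul_const e).const_add p
  have hder : ∀ {F : EuclideanSpace ℝ (Fin n) → ℝ}, ContDiff ℝ (⊤ : ℕ∞) F →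
      deriv (fun t : ℝ => F (p + t • e)) = fun t => partialDeriv i F (p + t • e) := by
    intro F hF
    funext t
    exact (hF.differentiableAt_top.hasFDerivAt.comp_hasDerivAt t (hline t)).deriv
  have hcont : Continuous fun t : ℝ => p + t • e := by fun_prop
  have hmax : IsLocalMax (fun t : ℝ => f (p + t • e)) 0 := by
    have : Filter.Tendsto (fun t : ℝ => p + t • e) (nhds 0) (nhds p) := by
      simpa using hcont.tendsto 0
    have := this.eventually h
    simpa [IsLocalMax, IsMaxFilter] using this
  have := hmax.deriv_deriv_nonpos (hf.continuous.comp hcont).continuousAt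
  rw [hder hf, hder (hf.partialDeriv i)] at this
  simpa using this

theorem IsLocalMax.lap_nonpos (h : IsLocalMax f p) (hf : ContDiff ℝ (⊤ : ℕ∞) f) :
    lap f p ≤ 0 :=
  Finset.sum_nonpos fun i _ => h.partialDeriv_partialDeriv_nonpos hf i

theorem lap_add (hf : ContDiff ℝ (⊤ : ℕ∞) f) (hg : ContDiff ℝ (⊤ : ℕ∞) g) :
    lap (fun y => f y + g y) x = lap f x + lap g x := by
  simp only [lap_eq_sum_partialDeriv, ← Finset.sum_add_distrib]
  refine Finset.sum_congr rfl fun i _ => ?_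
  have : partialDeriv i (fun y => f y + g y) =
      fun y => partialDeriv i f y + partialDeriv i g y :=
    funext fun y => partialDeriv_add hf.differentiableAt_top hg.differentiableAt_top i
  rw [this, partialDeriv_add (hf.partialDeriv i).differentiableAt_top
    (hg.partialDeriv i).differentiableAt_top]

theorem lap_const_mul (hf : ContDiff ℝ (⊤ : ℕ∞) f) (c : ℝ) :
    lap (fun y => c * f y) x = c * lap f x := by
  simp only [lap_eq_sum_partialDeriv, Finset.mul_sum]
  refine Finset.sum_congr rfl fun i _ => ?_
  have : partialDeriv i (fun y => c * f y) = fun y => c * partialDeriv i f y :=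
    funext fun y => partialDeriv_const_mul hf.differentiableAt_top c i
  rw [this, partialDeriv_const_mul (hf.partialDeriv i).differentiableAt_top]

theorem lap_mul (hf : ContDiff ℝ (⊤ : ℕ∞) f) (hg : ContDiff ℝ (⊤ : ℕ∞) g) :
    lap (fun y => f y * g y) x =
      f x * lap g x + 2 * (∑ i, partialDeriv i f x * partialDeriv i g x) + lap f x * g x := by
  simp only [lap_eq_sum_partialDeriv, Finset.mul_sum, Finset.sum_mul, ← Finset.sum_add_distrib]
  refine Finset.sum_congr rfl fun i _ => ?_
  have : partialDeriv i (fun y => f y * g y) =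
      fun y => f y * partialDeriv i g y + partialDeriv i f y * g y :=
    funext fun y => partialDeriv_mul hf.differentiableAt_top hg.differentiableAt_top i
  rw [this, partialDeriv_add (hf.mul (hg.partialDeriv i)).differentiableAt_top
      ((hf.partialDeriv i).mul hg).differentiableAt_top,
    partialDeriv_mul hf.differentiableAt_top (hg.partialDeriv i).differentiableAt_top,
    partialDeriv_mul (hf.partialDeriv i).differentiableAt_top hg.differentiableAt_top]
  ring

theorem lap_sum {ι : Type*} {s : Finset ι} {F : ι → EuclideanSpace ℝ (Fin n) → ℝ}
    (hF : ∀ k ∈ s, ContDiff ℝ (⊤ : ℕ∞) (F k)) :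
    lap (fun y => ∑ k ∈ s, F k y) x = ∑ k ∈ s, lap (F k) x := by
  simp only [lap_eq_sum_partialDeriv]
  rw [Finset.sum_comm]
  refine Finset.sum_congr rfl fun i _ => ?_
  have : partialDeriv i (fun y => ∑ k ∈ s, F k y) = fun y => ∑ k ∈ s, partialDeriv i (F k) y :=
    funext fun y => partialDeriv_sum (fun k hk => (hF k hk).differentiableAt_top) i
  rw [this, partialDeriv_sum fun k hk => ((hF k hk).partialDeriv i).differentiableAt_top]

theorem partialDeriv_lap (hf : ContDiff ℝ (⊤ : ℕ∞) f) (i : Fin n) :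
    partialDeriv i (lap f) x = lap (partialDeriv i f) x := by
  have : lap f = fun y => ∑ j, partialDeriv j (partialDeriv j f) y := rfl
  rw [this, partialDeriv_sum
    fun j _ => ((hf.partialDeriv j).partialDeriv j).differentiableAt_top,
    lap_eq_sum_partialDeriv]
  refine Finset.sum_congr rfl fun j _ => ?_
  rw [partialDeriv_comm (hf.partialDeriv j)]
  congr 1
  funext y
  exact partialDeriv_comm hf i j

/-- **Bochner's formula** in Euclidean space. -/
theorem lap_gradSq (hf : ContDiff ℝ (⊤ : ℕ∞) f) :
    lap (gradSq f) x = 2 * (∑ i, gradSq (partialDeriv i f) x) +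
      2 * ∑ i, partialDeriv i f x * partialDeriv i (lap f) x := by
  have : gradSq f = fun y => ∑ i, partialDeriv i f y * partialDeriv i f y := by
    funext y; simp [gradSq, sq]
  rw [this, lap_sum fun i _ => (hf.partialDeriv i).mul (hf.partialDeriv i), Finset.mul_sum,
    Finset.mul_sum, ← Finset.sum_add_distrib]
  refine Finset.sum_congr rfl fun i _ => ?_
  rw [lap_mul (hf.partialDeriv i) (hf.partialDeriv i), partialDeriv_lap hf]
  simp only [gradSq, sq]
  ring

theorem lap_sq_le (f : EuclideanSpace ℝ (Fin n) → ℝ) (x : EuclideanSpace ℝ (Fin n)) :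
    lap f x ^ 2 ≤ n * ∑ i, gradSq (partialDeriv i f) x := by
  have h := sq_sum_le_card_mul_sum_sq (s := Finset.univ)
    (f := fun i : Fin n => partialDeriv i (partialDeriv i f) x)
  rw [Finset.card_univ, Fintype.card_fin] at h
  refine h.trans (mul_le_mul_of_nonneg_left ?_ n.cast_nonneg)
  refine Finset.sum_le_sum fun i _ => ?_
  exact Finset.single_le_sum (f := fun j => partialDeriv j (partialDeriv i f) x ^ 2)
    (fun j _ => sq_nonneg _) (Finset.mem_univ i)

theorem contDiff_sq_norm_sub (x₀ : EuclideanSpace ℝ (Fin n)) :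
    ContDiff ℝ (⊤ : ℕ∞) fun y => ‖y - x₀‖ ^ 2 :=
  (contDiff_id.sub contDiff_const).norm_sq ℝ

theorem partialDeriv_sq_norm_sub (x₀ : EuclideanSpace ℝ (Fin n)) (i : Fin n) :
    partialDeriv i (fun y => ‖y - x₀‖ ^ 2) x = 2 * (x i - x₀ i) := by
  have := ((hasFDerivAt_id x).sub_const x₀).norm_sq.fderiv
  simp only [id] at this
  rw [partialDeriv, this]
  simp [EuclideanSpace.inner_single_right]

theorem lap_sq_norm_sub (x₀ : EuclideanSpace ℝ (Fin n)) :
    lap (fun y => ‖y - x₀‖ ^ 2) x = 2 * n := by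
  rw [lap_eq_sum_partialDeriv]
  have : ∀ i : Fin n, partialDeriv i (partialDeriv i fun y => ‖y - x₀‖ ^ 2) x = 2 := by
    intro i
    have h : (partialDeriv i fun y => ‖y - x₀‖ ^ 2) = fun y => 2 * (y i - x₀ i) :=
      funext fun y => partialDeriv_sq_norm_sub x₀ i
    have h' : HasFDerivAt (fun y : EuclideanSpace ℝ (Fin n) => 2 * (y i - x₀ i))
        ((2 : ℝ) • (EuclideanSpace.proj i : EuclideanSpace ℝ (Fin n) →L[ℝ] ℝ)) x :=
      ((EuclideanSpace.proj i : EuclideanSpace ℝ (Fin n) →L[ℝ] ℝ).hasFDerivAt.sub_const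
        (x₀ i)).const_mul 2
    rw [h, partialDeriv, h'.fderiv]
    simp
  simp [this, mul_comm]

theorem sum_sub_sq (x x₀ : EuclideanSpace ℝ (Fin n)) :
    ∑ i, (x i - x₀ i) ^ 2 = ‖x - x₀‖ ^ 2 := by
  simp [EuclideanSpace.norm_sq_eq]

end Calculus

section GradientEstimate

variable {n : ℕ} {v : EuclideanSpace ℝ (Fin n) → ℝ} {g g' : ℝ → ℝ}

theorem lap_gradSq_ge (hn : 1 ≤ n) (hv : ContDiff ℝ (⊤ : ℕ∞) v) {lam : ℝ}
    (hg : ∀ s, HasDerivAt g (g' s) s) (hg' : ∀ s, g' s ≤ lam)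
    (heq : ∀ x, lap v x = -(gradSq v x + g (v x))) (x : EuclideanSpace ℝ (Fin n)) :
    2 / n * (gradSq v x + g (v x)) ^ 2 - 2 * lam * gradSq v x
      - 2 * (∑ i, partialDeriv i v x * partialDeriv i (gradSq v) x) ≤ lap (gradSq v) x := by
  have hn0 : (0 : ℝ) < n := by exact_mod_cast hn
  have hlap : ∀ i, partialDeriv i (lap v) x =
      -1 * (partialDeriv i (gradSq v) x + g' (v x) * partialDeriv i v x) := by
    intro i
    have hgv : DifferentiableAt ℝ (fun y => g (v y)) x :=
      (hg (v x)).differentiableAt.comp x hv.differentiableAt_top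
    have : lap v = fun y => -1 * (gradSq v y + g (v y)) := by
      funext y; rw [heq]; ring
    rw [this, partialDeriv_const_mul (f := fun y => gradSq v y + g (v y))
        (hv.gradSq.differentiableAt_top.add hgv),
      partialDeriv_add hv.gradSq.differentiableAt_top hgv,
      partialDeriv_comp (hg (v x)) hv.differentiableAt_top]
  have hsum : ∑ i, partialDeriv i v x * partialDeriv i (lap v) x =
      -(∑ i, partialDeriv i v x * partialDeriv i (gradSq v) x) - g' (v x) * gradSq v x := by
    rw [gradSq, Finset.mul_sum, ← Finset.sum_neg_distrib, ← Finset.sum_sub_distrib]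
    refine Finset.sum_congr rfl fun i _ => ?_
    rw [hlap]
    ring
  have hess := lap_sq_le v x
  rw [heq, neg_sq] at hess
  have hess' : 1 / n * (gradSq v x + g (v x)) ^ 2 ≤ ∑ i, gradSq (partialDeriv i v) x := by
    rw [one_div, inv_mul_le_iff₀ hn0]
    exact hess
  have hg'w : g' (v x) * gradSq v x ≤ lam * gradSq v x :=
    mul_le_mul_of_nonneg_right (hg' _) (gradSq_nonneg v x)
  rw [lap_gradSq hv, hsum]
  have : 2 / (n : ℝ) * (gradSq v x + g (v x)) ^ 2 =
    2 * (1 / n * (gradSq v x + g (v x)) ^ 2) := by ring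
  linarith

/-- The first and second order conditions at an interior maximum of `(1 - ‖x - x₀‖²)² w`. -/
theorem cutoff_lap_le {w : EuclideanSpace ℝ (Fin n) → ℝ} (hw : ContDiff ℝ (⊤ : ℕ∞) w)
    {x₀ p : EuclideanSpace ℝ (Fin n)}
    (hmax : IsLocalMax (fun y => (1 - ‖y - x₀‖ ^ 2) ^ 2 * w y) p)
    (hp : ‖p - x₀‖ < 1) (hwp : 0 ≤ w p) :
    (∀ i, (1 - ‖p - x₀‖ ^ 2) * partialDeriv i w p = 4 * (p i - x₀ i) * w p) ∧
      (1 - ‖p - x₀‖ ^ 2) ^ 2 * lap w p ≤ (24 + 4 * n) * w p := by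
  set r : EuclideanSpace ℝ (Fin n) → ℝ := fun y => 1 + -1 * ‖y - x₀‖ ^ 2 with hr
  have hs := contDiff_sq_norm_sub x₀
  have hs1 : ContDiff ℝ (⊤ : ℕ∞) fun y => -1 * ‖y - x₀‖ ^ 2 := contDiff_const.mul hs
  have hrc : ContDiff ℝ (⊤ : ℕ∞) r := contDiff_const.add hs1
  have hr_partial : ∀ y i, partialDeriv i r y = -2 * (y i - x₀ i) := by
    intro y i
    rw [hr, partialDeriv_add (by fun_prop) hs1.differentiableAt_top,
      partialDeriv_const_mul hs.differentiableAt_top, partialDeriv_sq_norm_sub]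
    simp [partialDeriv]
  have hr_lap : lap r p = -2 * n := by
    rw [hr, lap_add contDiff_const hs1, lap_const_mul hs, lap_sq_norm_sub]
    simp [lap]
  have hF : (fun y => (1 - ‖y - x₀‖ ^ 2) ^ 2 * w y) = fun y => r y * (r y * w y) := by
    funext y; simp only [hr]; ring
  have hrw := hrc.mul hw
  have hrp : 1 - ‖p - x₀‖ ^ 2 = r p := by simp only [hr]; ring
  have hnorm : ‖p - x₀‖ ^ 2 = 1 - r p := by linarith
  have hrpos : 0 < r p := by
    have := norm_nonneg (p - x₀)
    rw [← hrp]; nlinarith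
  rw [hF] at hmax
  rw [hrp]
  have h1 : ∀ i, r p * partialDeriv i w p = 4 * (p i - x₀ i) * w p := by
    intro i
    have h := hmax.partialDeriv_eq_zero i
    rw [partialDeriv_mul hrc.differentiableAt_top hrw.differentiableAt_top,
      partialDeriv_mul hrc.differentiableAt_top hw.differentiableAt_top, hr_partial] at h
    refine mul_left_cancel₀ hrpos.ne' ?_
    linarith
  refine ⟨h1, ?_⟩
  have h2 := hmax.lap_nonpos (hrc.mul hrw)
  rw [lap_mul hrc hrw, lap_mul hrc hw, hr_lap] at h2
  have hsum1 : r p * ∑ i, partialDeriv i r p * partialDeriv i w p =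
      -8 * (1 - r p) * w p := by
    rw [← hnorm, ← sum_sub_sq, Finset.mul_sum, Finset.mul_sum, Finset.sum_mul]
    refine Finset.sum_congr rfl fun i _ => ?_
    rw [mul_left_comm, h1, hr_partial]
    ring
  have hsum2 : ∑ i, partialDeriv i r p * partialDeriv i (fun y => r y * w y) p =
      -4 * (1 - r p) * w p := by
    rw [← hnorm, ← sum_sub_sq, Finset.mul_sum, Finset.sum_mul]
    refine Finset.sum_congr rfl fun i _ => ?_
    rw [partialDeriv_mul hrc.differentiableAt_top hw.differentiableAt_top, h1, hr_partial]
    ring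
  rw [hsum2] at h2
  have hrw0 : 0 ≤ r p * w p := mul_nonneg hrpos.le hwp
  have hr1 : r p ≤ 1 := by linarith [sq_nonneg ‖p - x₀‖]
  have hn : 0 ≤ n * ((1 - r p) * w p) :=
    mul_nonneg n.cast_nonneg (mul_nonneg (by linarith) hwp)
  nlinarith

/-- Universal gradient bound for `Δv + |∇v|² + g(v) = 0` with `g` bounded below and `g'`
bounded above. -/
theorem gradSq_le (hn : 1 ≤ n) (hv : ContDiff ℝ (⊤ : ℕ∞) v) {lam K : ℝ}
    (hlam : 0 ≤ lam) (hK : 0 ≤ K)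
    (hg : ∀ s, HasDerivAt g (g' s) s) (hg' : ∀ s, g' s ≤ lam) (hgK : ∀ s, -K ≤ g s)
    (heq : ∀ x, lap v x = -(gradSq v x + g (v x))) (x₀ : EuclideanSpace ℝ (Fin n)) :
    gradSq v x₀ ≤ 2 * K + 4 * n * (24 + 4 * n + 2 * lam) + 256 * n ^ 2 := by
  have hn0 : (0 : ℝ) < n := by exact_mod_cast hn
  set F : EuclideanSpace ℝ (Fin n) → ℝ := fun y => (1 - ‖y - x₀‖ ^ 2) ^ 2 * gradSq v y with hF
  have hFc : Continuous F := by
    have := hv.gradSq.continuous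
    fun_prop
  obtain ⟨p, hp, hmax⟩ := (isCompact_closedBall x₀ 1).exists_isMaxOn
    ⟨x₀, mem_closedBall_self zero_le_one⟩ hFc.continuousOn
  have hF0 : gradSq v x₀ ≤ F p := by
    have : F x₀ ≤ F p := hmax (mem_closedBall_self zero_le_one)
    simpa [hF] using this
  refine hF0.trans ?_
  have hw := gradSq_nonneg v p
  have hpos : 0 ≤ 2 * K + 4 * n * (24 + 4 * n + 2 * lam) + 256 * (n : ℝ) ^ 2 := by positivity
  rw [mem_closedBall, dist_eq_norm] at hp
  rcases hp.eq_or_lt with hp1 | hp1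
  · simpa [hF, hp1] using hpos
  have hloc : IsLocalMax F p := by
    refine hmax.isLocalMax (Filter.mem_of_superset (isOpen_ball.mem_nhds ?_) ball_subset_closedBall)
    rwa [mem_ball, dist_eq_norm]
  obtain ⟨h1, h2⟩ := cutoff_lap_le hv.gradSq hloc hp1 hw
  have h3 := lap_gradSq_ge hn hv hg hg' heq p
  have hFp : F p = (1 - ‖p - x₀‖ ^ 2) ^ 2 * gradSq v p := rfl
  have hnn := norm_nonneg (p - x₀)
  have hnorm1 : ‖p - x₀‖ ^ 2 ≤ 1 := by nlinarith
  have hq : (∑ i, (p i - x₀ i) * partialDeriv i v p) ^ 2 ≤ gradSq v p := by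
    refine (Finset.sum_mul_sq_le_sq_mul_sq _ _ _).trans ?_
    rw [sum_sub_sq]
    exact mul_le_of_le_one_left hw hnorm1
  have hcross : (1 - ‖p - x₀‖ ^ 2) *
      ∑ i, partialDeriv i v p * partialDeriv i (gradSq v) p =
      4 * gradSq v p * ∑ i, (p i - x₀ i) * partialDeriv i v p := by
    rw [Finset.mul_sum, Finset.mul_sum]
    refine Finset.sum_congr rfl fun i _ => ?_
    rw [mul_left_comm, h1]
    ring
  have hg0 := hgK (v p)
  have hr0 : 0 ≤ 1 - ‖p - x₀‖ ^ 2 := by linarith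
  have hr1 : 1 - ‖p - x₀‖ ^ 2 ≤ 1 := by nlinarith
  rw [hFp]
  generalize 1 - ‖p - x₀‖ ^ 2 = r at *
  generalize gradSq v p = w at *
  generalize ∑ i, (p i - x₀ i) * partialDeriv i v p = q at *
  generalize ∑ i, partialDeriv i v p * partialDeriv i (gradSq v) p = S at *
  generalize g (v p) = G at *
  have hr2 : r ^ 2 ≤ 1 := by nlinarith
  rcases le_or_gt w (2 * K) with hwK | hwK
  · have : r ^ 2 * w ≤ w := mul_le_of_le_one_left hw hr2
    have : 0 ≤ 4 * n * (24 + 4 * n + 2 * lam) + 256 * (n : ℝ) ^ 2 := by positivity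
    linarith
  have hwpos : 0 < w := by linarith
  have hsq : w ^ 2 / 4 ≤ (w + G) ^ 2 := by nlinarith
  have h4 : r ^ 2 * (2 / n * (w ^ 2 / 4) - 2 * lam * w - 2 * S) ≤ (24 + 4 * n) * w := by
    refine le_trans (mul_le_mul_of_nonneg_left ?_ (sq_nonneg r)) h2
    refine le_trans ?_ h3
    gcongr
  have h5 : r ^ 2 * w / (2 * n) ≤ 24 + 4 * n + 2 * lam + 8 * (r * q) := by
    refine le_of_mul_le_mul_right ?_ hwpos
    have e1 : r ^ 2 * S = 4 * w * q * r := by rw [sq, mul_assoc, hcross]; ring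
    have e2 : r ^ 2 * (2 / n * (w ^ 2 / 4)) = r ^ 2 * w / (2 * n) * w := by
      field_simp; ring
    have e3 : r ^ 2 * (lam * w) ≤ lam * w := mul_le_of_le_one_left (by positivity) hr2
    nlinarith
  rw [div_le_iff₀ (by positivity)] at h5
  have h6 : (r * q) ^ 2 ≤ r ^ 2 * w := by
    rw [mul_pow]; exact mul_le_mul_of_nonneg_left hq (sq_nonneg r)
  nlinarith [sq_nonneg (r * q - 16 * n)]

theorem exists_dist_le_one_le_of_gradSq_le (hv : ContDiff ℝ (⊤ : ℕ∞) v) {L : ℝ} (hL : 0 ≤ L)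
    (hgrad : ∀ x, gradSq v x ≤ L ^ 2)
    (heq : ∀ x, lap v x = -(gradSq v x + g (v x))) (x₀ : EuclideanSpace ℝ (Fin n)) :
    ∃ p, |v p - v x₀| ≤ L ∧ g (v p) ≤ 2 * n * (L + 1) := by
  have hlip : ∀ y, |v y - v x₀| ≤ L * ‖y - x₀‖ := by
    intro y
    have := convex_univ.norm_image_sub_le_of_norm_fderiv_le (𝕜 := ℝ) (f := v) (C := L)
      (fun x _ => hv.differentiableAt_top)
      (fun x _ => (norm_fderiv_le_sqrt_gradSq v x).trans
        (Real.sqrt_le_iff.2 ⟨hL, hgrad x⟩)) (Set.mem_univ x₀) (Set.mem_univ y)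
    simpa using this
  have hs := contDiff_sq_norm_sub x₀
  have hvn : ContDiff ℝ (⊤ : ℕ∞) fun y => -1 * v y := contDiff_const.mul hv
  have hsn : ContDiff ℝ (⊤ : ℕ∞) fun y => -(L + 1) * ‖y - x₀‖ ^ 2 := contDiff_const.mul hs
  have hF := hvn.add hsn
  obtain ⟨p, hp, hmax⟩ := (isCompact_closedBall x₀ 1).exists_isMaxOn
    ⟨x₀, mem_closedBall_self zero_le_one⟩ hF.continuous.continuousOn
  have h0 := hmax (mem_closedBall_self zero_le_one)
  rw [mem_closedBall, dist_eq_norm] at hp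
  simp only [Set.mem_ofPred_eq, sub_self, norm_zero] at h0
  have hvp := abs_le.1 (hlip p)
  refine ⟨p, (hlip p).trans (mul_le_of_le_one_right hL hp), ?_⟩
  have hp1 : ‖p - x₀‖ < 1 := by
    refine hp.lt_of_ne fun h => ?_
    rw [h] at h0 hvp
    linarith
  have hloc := hmax.isLocalMax (Filter.mem_of_superset (isOpen_ball.mem_nhds
    (show p ∈ ball x₀ 1 by rwa [mem_ball, dist_eq_norm])) ball_subset_closedBall)
  have hlap := hloc.lap_nonpos hF
  rw [lap_add hvn hsn, lap_const_mul hv, lap_const_mul hs, lap_sq_norm_sub, heq] at hlap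
  have := gradSq_nonneg v p
  linarith

theorem lap_log {u : EuclideanSpace ℝ (Fin n) → ℝ} (hu : ContDiff ℝ (⊤ : ℕ∞) u)
    (hpos : ∀ x, 0 < u x) (x : EuclideanSpace ℝ (Fin n)) :
    lap u x = u x * (gradSq (fun y => Real.log (u y)) x + lap (fun y => Real.log (u y)) x) := by
  have hv : ContDiff ℝ (⊤ : ℕ∞) fun y => Real.log (u y) := hu.log fun y => (hpos y).ne'
  rw [lap_eq_sum_partialDeriv, lap_eq_sum_partialDeriv, gradSq, ← Finset.sum_add_distrib,
    Finset.mul_sum]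
  refine Finset.sum_congr rfl fun i _ => ?_
  set v : EuclideanSpace ℝ (Fin n) → ℝ := fun y => Real.log (u y) with hvdef
  have huv : u = fun y => Real.exp (v y) := funext fun y => (Real.exp_log (hpos y)).symm
  have hpu : partialDeriv i u = fun y => u y * partialDeriv i v y := by
    funext y
    conv_lhs => rw [huv]
    rw [partialDeriv_comp (Real.hasDerivAt_exp (v y)) hv.differentiableAt_top, hvdef,
      Real.exp_log (hpos y)]
  have hpux := congrFun hpu x
  rw [hpu, partialDeriv_mul hu.differentiableAt_top (hv.partialDeriv i).differentiableAt_top,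
    hpux]
  ring

end GradientEstimate

theorem quadratic_le_exp_mul_of_nonpos {b s : ℝ} (hb : b ≤ 0) (hs : s ≤ 0) :
    b ^ 2 / 2 * s ^ 2 ≤ Real.exp (b * s) := by
  have h := Real.quadratic_le_exp_of_nonneg (mul_nonneg_of_nonpos_of_nonpos hb hs)
  have := mul_nonneg_of_nonpos_of_nonpos hb hs
  nlinarith

/-- Corollary 1.0 (Euclidean case), part 1: if `λ₁ > 0`, `λ₂ > 0`, `b < 0`, then every
global smooth positive solution of `Δu + λ₁ u ln u + λ₂ u^(b+1) = 0` on `ℝⁿ` is bounded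
above and bounded away from zero, with bounds depending only on `n, λ₁, λ₂, b`. -/
theorem stmt_2 (n : ℕ) (hn : 1 ≤ n) (lam1 lam2 b : ℝ)
    (hlam1 : 0 < lam1) (hlam2 : 0 < lam2) (hb : b < 0) :
    ∃ m M : ℝ, 0 < m ∧ m ≤ M ∧
      ∀ u : EuclideanSpace ℝ (Fin n) → ℝ,
        ContDiff ℝ (⊤ : ℕ∞) u →
        (∀ x, 0 < u x) →
        (∀ x, lap u x + lam1 * u x * Real.log (u x) + lam2 * u x ^ (b + 1) = 0) →
        ∀ x, m ≤ u x ∧ u x ≤ M := by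
 
  set g : ℝ → ℝ := fun s => lam1 * s + lam2 * Real.exp (b * s) with hgdef
  set c : ℝ := lam2 * (b ^ 2 / 2) with hc
  have hcpos : 0 < c := by have := sq_pos_of_neg hb; positivity
  have hquad : ∀ s ≤ 0, lam1 * s + c * s ^ 2 ≤ g s := by
    intro s hs
    have := mul_le_mul_of_nonneg_left (quadratic_le_exp_mul_of_nonpos hb.le hs) hlam2.le
    simp only [hgdef, hc]
    linarith
  have hgpos : ∀ s, lam1 * s ≤ g s := fun s => by
    have := Real.exp_pos (b * s)
    simp only [hgdef]
    nlinarith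
  set K : ℝ := lam1 ^ 2 / (4 * c) with hK
  have hK0 : 0 ≤ K := by positivity
  have hgK : ∀ s, -K ≤ g s := by
    intro s
    rcases le_total 0 s with hs | hs
    · have := hgpos s
      have : 0 ≤ lam1 * s := by positivity
      linarith
    · have hsq : lam1 * s + c * s ^ 2 + K = c * (s + lam1 / (2 * c)) ^ 2 := by
        rw [hK]; field_simp; ring
      have : 0 ≤ c * (s + lam1 / (2 * c)) ^ 2 := by positivity
      have := hquad s hs
      linarith
  have hgd : ∀ s, HasDerivAt g (lam1 + lam2 * (Real.exp (b * s) * b)) s := by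
    intro s
    have h1 : HasDerivAt (fun s : ℝ => b * s) b s := by
      simpa using (hasDerivAt_id s).const_mul b
    have h2 : HasDerivAt (fun s : ℝ => lam1 * s) lam1 s := by
      simpa using (hasDerivAt_id s).const_mul lam1
    exact h2.add (h1.exp.const_mul lam2)
  have hgd' : ∀ s, lam1 + lam2 * (Real.exp (b * s) * b) ≤ lam1 := by
    intro s
    have := mul_nonpos_of_nonneg_of_nonpos hlam2.le
      (mul_nonpos_of_nonneg_of_nonpos (Real.exp_pos (b * s)).le hb.le)
    linarith
  set C : ℝ := 2 * K + 4 * n * (24 + 4 * n + 2 * lam1) + 256 * (n : ℝ) ^ 2 with hC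
  have hC0 : 0 ≤ C := by positivity
  set L : ℝ := √C with hL
  have hL0 : 0 ≤ L := Real.sqrt_nonneg C
  set B : ℝ := 2 * n * (L + 1) with hB
  have hB0 : 0 ≤ B := by positivity
  set T : ℝ := 1 + (lam1 + B) / c with hT
  have hT1 : 1 ≤ T := by
    have : 0 ≤ (lam1 + B) / c := by positivity
    linarith
  have hcT : c * T = c + (lam1 + B) := by rw [hT]; field_simp
  have hupper : ∀ s, g s ≤ B → s ≤ B / lam1 := by
    intro s hs
    rw [le_div_iff₀ hlam1]
    linarith [hgpos s]
  have hlower : ∀ s, g s ≤ B → -T ≤ s := by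
    intro s hs
    by_contra! hlt
    have h1 := hquad s (by linarith)
    have h2 : c + (lam1 + B) ≤ c * (-s) := by
      rw [← hcT]
      exact mul_le_mul_of_nonneg_left (by linarith) hcpos.le
    have h3 := mul_le_mul_of_nonneg_right h2 (show 0 ≤ -s by linarith)
    have h4 : c + B ≤ (c + B) * (-s) := le_mul_of_one_le_right (by linarith) (by linarith)
    nlinarith
  refine ⟨Real.exp (-T - L), Real.exp (B / lam1 + L), Real.exp_pos _, ?_, ?_⟩
  · rw [Real.exp_le_exp]
    have : 0 ≤ B / lam1 := by positivity
    linarith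
  intro u hu hpos heq x
  set v : EuclideanSpace ℝ (Fin n) → ℝ := fun y => Real.log (u y) with hvdef
  have hv : ContDiff ℝ (⊤ : ℕ∞) v := hu.log fun y => (hpos y).ne'
  have hveq : ∀ y, lap v y = -(gradSq v y + g (v y)) := by
    intro y
    have h := heq y
    have hpow : u y ^ (b + 1) = u y * Real.exp (b * v y) := by
      rw [Real.rpow_add_one (hpos y).ne', Real.rpow_def_of_pos (hpos y), mul_comm (Real.log _),
        mul_comm]
    rw [lap_log hu hpos, hpow] at h
    have h' : u y * (gradSq v y + lap v y + g (v y)) = 0 := by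
      rw [← h]; simp only [hgdef, hvdef]; ring
    have := (mul_eq_zero.1 h').resolve_left (hpos y).ne'
    linarith
  have hgrad : ∀ y, gradSq v y ≤ L ^ 2 := by
    intro y
    rw [hL, Real.sq_sqrt hC0]
    exact gradSq_le hn hv hlam1.le hK0 hgd hgd' hgK hveq y
  obtain ⟨p, hp, hgp⟩ := exists_dist_le_one_le_of_gradSq_le hv hL0 hgrad hveq x
  have hp' := abs_le.1 hp
  have h1 := hupper _ hgp
  have h2 := hlower _ hgp
  have hux : u x = Real.exp (v x) := (Real.exp_log (hpos x)).symm
  rw [hux, Real.exp_le_exp, Real.exp_le_exp]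
  constructor <;> linarith
end

section
/- Let n ≥ 1 be an integer and let λ₁ ≤ 0, λ₂ > 0 and b < 0 be constants. Then there exists a constant m > 0, depending only on n, λ₂ and b, such that every smooth positive solution u of Δu + λ₁ u ln u + λ₂ u^{b+1} = 0 on all of ℝⁿ satisfies u(x) ≥ m for every x ∈ ℝⁿ. -/
open Real Metric

/-- Second-order necessary condition for a local minimum on the real line. -/
lemma IsLocalMin.nonneg_of_hasDerivAt_hasDerivAt {f f' : ℝ → ℝ} {x d : ℝ} (h : IsLocalMin f x)
    (hf : ∀ s, HasDerivAt f (f' s) s) (hf' : HasDerivAt f' d x) : 0 ≤ d := by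
  by_contra! hd
  have hderiv : deriv f = f' := funext fun s => (hf s).deriv
  have hmax : IsLocalMax f x := by
    refine isLocalMax_of_deriv_deriv_neg ?_ h.deriv_eq_zero (hf x).continuousAt
    rwa [hderiv, hf'.deriv]
  have hconst : f =ᶠ[nhds x] fun _ => f x := by
    filter_upwards [h, hmax] with s h₁ h₂ using le_antisymm h₂ h₁
  have hzero : deriv (deriv f) x = 0 := by
    rw [hconst.deriv.deriv_eq]
    simp
  rw [hderiv, hf'.deriv] at hzero
  exact hd.ne hzero

/-- If `t * u - c * (1 - ‖· - x₀‖²) ^ (j + 1)` has a local minimum at `x` inside the unit ball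
around `x₀`, then the pure second derivatives of `t * u` at `x` are bounded below. -/
lemma neg_le_mul_fderiv_fderiv_of_isLocalMin {E : Type*} [NormedAddCommGroup E]
    [InnerProductSpace ℝ E] {u : E → ℝ} (hu : ContDiff ℝ 2 u)
    {t c : ℝ} (hc : 0 ≤ c) {j : ℕ} {x₀ x e : E} (he : ‖e‖ = 1) (hx : 0 ≤ 1 - ‖x - x₀‖ ^ 2)
    (hmin : IsLocalMin (fun y => t * u y - c * (1 - ‖y - x₀‖ ^ 2) ^ (j + 1)) x) :
    -(2 * c * (j + 1) * (1 - ‖x - x₀‖ ^ 2) ^ j) ≤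
      t * fderiv ℝ (fun y => fderiv ℝ u y e) x e := by
  set ρ := 1 - ‖x - x₀‖ ^ 2
  set a := inner ℝ (x - x₀) e
  have hline (s : ℝ) : HasDerivAt (fun s : ℝ => x + s • e) e s := by
    simpa using ((hasDerivAt_id s).smul_const e).const_add x
  have hu' : ContDiff ℝ 1 (fun y => fderiv ℝ u y e) :=
    (hu.fderiv_right (m := 1) (by norm_num)).clm_apply contDiff_const
  have hu₁ (s : ℝ) : HasDerivAt (fun s : ℝ => u (x + s • e)) (fderiv ℝ u (x + s • e) e) s :=
    ((hu.differentiable (by norm_num)) _).hasFDerivAt.comp_hasDerivAt s (hline s)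
  have hu₂ : HasDerivAt (fun s : ℝ => fderiv ℝ u (x + s • e) e)
      (fderiv ℝ (fun y => fderiv ℝ u y e) x e) 0 := by
    have := ((hu'.differentiable (by norm_num)) (x + (0 : ℝ) • e)).hasFDerivAt.comp_hasDerivAt
      (0 : ℝ) (hline 0)
    simpa [Function.comp_def] using this
  have hq (s : ℝ) : 1 - ‖x + s • e - x₀‖ ^ 2 = ρ - 2 * a * s - s ^ 2 := by
    rw [add_sub_right_comm, norm_add_sq_real, norm_smul, inner_smul_right, he]
    simp only [mul_one, norm_eq_abs, sq_abs, ρ, a]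
    ring
  have hq₁ (s : ℝ) : HasDerivAt (fun s : ℝ => ρ - 2 * a * s - s ^ 2) (-2 * a - 2 * s) s := by
    have := (((hasDerivAt_id s).const_mul (2 * a)).const_sub ρ).sub ((hasDerivAt_id s).pow 2)
    refine this.congr_deriv ?_
    simp
  have hq₂ : HasDerivAt (fun s : ℝ => -2 * a - 2 * s) (-2) 0 := by
    simpa using ((hasDerivAt_id (0 : ℝ)).const_mul 2).const_sub (-2 * a)
  have hmin' : IsLocalMin
      (fun s : ℝ => t * u (x + s • e) - c * (ρ - 2 * a * s - s ^ 2) ^ (j + 1)) 0 := by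
    have hmin₀ : IsLocalMin (fun y => t * u y - c * (1 - ‖y - x₀‖ ^ 2) ^ (j + 1))
        (x + (0 : ℝ) • e) := by simpa using hmin
    have := IsLocalMin.comp_continuous (g := fun s : ℝ => x + s • e) (b := 0) hmin₀
      (by fun_prop)
    simpa only [Function.comp_def, hq] using this
  have key := hmin'.nonneg_of_hasDerivAt_hasDerivAt
    (fun s => ((hu₁ s).const_mul t).sub (((hq₁ s).pow (j + 1)).const_mul c))
    ((hu₂.const_mul t).sub (((((hq₁ 0).pow j).const_mul ((j + 1 : ℕ) : ℝ)).mul hq₂).const_mul c))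
  simp only [Pi.pow_apply] at key
  have hpos : 0 ≤ c * ((j + 1) * (j * ρ ^ (j - 1) * (4 * a ^ 2))) := by positivity
  push_cast at key
  norm_num at key
  nlinarith

theorem stmt_3 (n : ℕ) (hn : 1 ≤ n) (lam2 b : ℝ) (hlam2 : 0 < lam2) (hb : b < 0) :
    ∃ m : ℝ, 0 < m ∧
      ∀ lam1 : ℝ, lam1 ≤ 0 →
        ∀ u : EuclideanSpace ℝ (Fin n) → ℝ,
          ContDiff ℝ (⊤ : ℕ∞) u →
          (∀ x, 0 < u x) →
          (∀ x, lap u x + lam1 * u x * Real.log (u x) + lam2 * u x ^ (b + 1) = 0) →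
          ∀ x, m ≤ u x := by
  obtain ⟨j, hj⟩ : ∃ j : ℕ, ((j : ℝ) + 1) * b ≤ -1 := by
    obtain ⟨j, hj⟩ := exists_nat_ge (-1 / b)
    refine ⟨j, ?_⟩
    rw [div_le_iff_of_neg hb] at hj
    nlinarith
  obtain ⟨c, hc0, hc1, hc⟩ : ∃ c : ℝ, 0 < c ∧ c ≤ 1 ∧ 2 * n * (j + 1) ≤ lam2 * c ^ b := by
    set K : ℝ := 2 * n * (j + 1) / lam2
    have hK : 0 ≤ K := by positivity
    refine ⟨exp (K / b), exp_pos _, exp_le_one_iff.2 (div_nonpos_of_nonneg_of_nonpos hK hb.le), ?_⟩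
    rw [← exp_mul, div_mul_cancel₀ _ hb.ne, mul_comm lam2, ← div_le_iff₀ hlam2]
    linarith [add_one_le_exp K]
  refine ⟨c, hc0, fun lam1 hlam1 u hu hpos heq x₀ => ?_⟩
  by_contra! hlt
  set ψ : EuclideanSpace ℝ (Fin n) → ℝ := fun y => c * (1 - ‖y - x₀‖ ^ 2) ^ (j + 1) with hψ
  have hcont : Continuous fun y => ψ y / u y :=
    Continuous.div (by fun_prop) hu.continuous fun y => (hpos y).ne'
  obtain ⟨x, hx, hxmax⟩ := (isCompact_closedBall x₀ 1).exists_isMaxOn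
    (nonempty_closedBall.2 zero_le_one) hcont.continuousOn
  set t := ψ x / u x
  have ht1 : 1 < t := by
    have h₀ : ψ x₀ / u x₀ ≤ t := hxmax (mem_closedBall_self zero_le_one)
    refine lt_of_lt_of_le ?_ h₀
    rw [one_lt_div (hpos _)]
    simpa [hψ] using hlt
  have htu : ψ x = t * u x := (div_mul_cancel₀ _ (hpos x).ne').symm
  have huψ : u x < ψ x := by rw [htu]; nlinarith [hpos x]
  have hxle : ‖x - x₀‖ ≤ 1 := by rwa [mem_closedBall, dist_eq_norm] at hx
  have hxlt : ‖x - x₀‖ < 1 := by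
    refine lt_of_le_of_ne hxle fun h => ?_
    have : ψ x = 0 := by simp [hψ, h]
    linarith [hpos x]
  have hρ0 : 0 < 1 - ‖x - x₀‖ ^ 2 := by nlinarith [norm_nonneg (x - x₀)]
  have hρ1 : 1 - ‖x - x₀‖ ^ 2 ≤ 1 := by nlinarith [norm_nonneg (x - x₀)]
  have hmin : IsLocalMin (fun y => t * u y - ψ y) x := by
    have hball : closedBall x₀ 1 ∈ nhds x :=
      Filter.mem_of_superset (isOpen_ball.mem_nhds (by rwa [mem_ball, dist_eq_norm]))
        ball_subset_closedBall
    filter_upwards [hball] with y hy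
    have : ψ y / u y ≤ t := hxmax hy
    rw [div_le_iff₀ (hpos y)] at this
    linarith
  have hlap : -(2 * n * c * (j + 1) * (1 - ‖x - x₀‖ ^ 2) ^ j) ≤ t * lap u x := by
    have hsum := Finset.sum_le_sum fun (i : Fin n) (_ : i ∈ Finset.univ) =>
      neg_le_mul_fderiv_fderiv_of_isLocalMin (e := EuclideanSpace.single i (1 : ℝ))
        (hu.of_le (WithTop.coe_le_coe.2 le_top)) hc0.le (by simp) hρ0.le hmin
    rw [Finset.sum_const, Finset.card_univ, Fintype.card_fin, nsmul_eq_mul,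
      ← Finset.mul_sum] at hsum
    calc _ = _ := by ring
      _ ≤ _ := hsum
  set ρ := 1 - ‖x - x₀‖ ^ 2
  have hψx : ψ x = c * ρ ^ (j + 1) := rfl
  have hu1 : u x ≤ 1 :=
    huψ.le.trans (hψx ▸ mul_le_one₀ hc1 (by positivity) (pow_le_one₀ hρ0.le hρ1))
  have hlapu : lap u x ≤ -(lam2 * (u x * u x ^ b)) := by
    have h := heq x
    rw [rpow_add_one (hpos x).ne'] at h
    have : 0 ≤ lam1 * u x * log (u x) :=
      mul_nonneg_of_nonpos_of_nonpos (mul_nonpos_of_nonpos_of_nonneg hlam1 (hpos x).le)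
        (log_nonpos (hpos x).le hu1)
    linarith
  have hub : c ^ b * ρ⁻¹ < u x ^ b := by
    calc c ^ b * ρ⁻¹ ≤ c ^ b * ρ ^ (((j : ℝ) + 1) * b) := by
          gcongr
          rw [← rpow_neg_one]
          exact rpow_le_rpow_of_exponent_ge hρ0 hρ1 hj
      _ = ψ x ^ b := by
          rw [hψx, mul_rpow hc0.le (by positivity), ← rpow_natCast, ← rpow_mul hρ0.le]
          push_cast
          rfl
      _ < u x ^ b := rpow_lt_rpow_of_neg (hpos x) huψ hb
  have hupper : t * lap u x < -(lam2 * (c * ρ ^ (j + 1) * (c ^ b * ρ⁻¹))) := by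
    calc t * lap u x ≤ t * -(lam2 * (u x * u x ^ b)) := by gcongr
      _ = -(lam2 * (c * ρ ^ (j + 1) * u x ^ b)) := by rw [← hψx, htu]; ring
      _ < _ := by gcongr
  have hsimp : lam2 * (c * ρ ^ (j + 1) * (c ^ b * ρ⁻¹)) = (lam2 * c ^ b) * (c * ρ ^ j) := by
    field_simp
    ring
  have := mul_le_mul_of_nonneg_right hc (by positivity : 0 ≤ c * ρ ^ j)
  linarith
end
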